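/- Suppose R₀ < ∞ and Ω(1) > 0, and let (Ψ, ξ, R) satisfy the water-wave problem with R > R_c, Ψ_Y ≥ 0 in the closure of D_ξ, and Ψ_Y(X, ξ(X)) ≥ δ for some δ > 0 and all X ∈ ℝ. Then the bottom velocity satisfies Ψ_Y(X, 0) ≥ θ₀ for every X ∈ ℝ. -/

import Mathlib

/-- `Omg ω τ = ∫₀^τ ω(s) ds`. -/
noncomputable def Omg (ω : ℝ → ℝ) (τ : ℝ) : ℝ := ∫ s in (0:ℝ)..τ, ω s

/-- `theta0 ω = √(2 · max_{τ∈[0,1]} Ω(τ))`. -/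
noncomputable def theta0 (ω : ℝ → ℝ) : ℝ := Real.sqrt (2 * sSup (Omg ω '' Set.Icc 0 1))

/-- `Rcal ω θ = θ²/2 + ∫₀¹ (θ² − 2Ω(τ))^{−1/2} dτ − Ω(1)`. -/
noncomputable def Rcal (ω : ℝ → ℝ) (θ : ℝ) : ℝ :=
  θ ^ 2 / 2 + (∫ τ in (0:ℝ)..1, 1 / Real.sqrt (θ ^ 2 - 2 * Omg ω τ)) - Omg ω 1

/-- The critical Bernoulli constant `R_c = inf_{θ>θ₀} ℛ(θ)`. -/
noncomputable def Rc (ω : ℝ → ℝ) : ℝ := sInf (Rcal ω '' Set.Ioi (theta0 ω))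

/-- The fluid domain `D_ξ = {(X,Y) : 0 < Y < ξ(X)}`. -/
def fluidDomain (ξ : ℝ → ℝ) : Set (ℝ × ℝ) := {z : ℝ × ℝ | 0 < z.2 ∧ z.2 < ξ z.1}

/-- `Ψ_X`, computed within the closed fluid domain. -/
noncomputable def psiX (ξ : ℝ → ℝ) (Ψ : ℝ × ℝ → ℝ) (z : ℝ × ℝ) : ℝ :=
  fderivWithin ℝ Ψ (closure (fluidDomain ξ)) z (1, 0)

/-- `Ψ_Y`, computed within the closed fluid domain. -/
noncomputable def psiY (ξ : ℝ → ℝ) (Ψ : ℝ × ℝ → ℝ) (z : ℝ × ℝ) : ℝ :=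
  fderivWithin ℝ Ψ (closure (fluidDomain ξ)) z (0, 1)

/-- The water-wave problem (unit flux, unit gravity): `ξ : ℝ → (0,∞)` is `C¹`, `ω` is `C¹` on
`[0,1]`, `Ψ` is `C¹` on the closure of `D_ξ` and `C²` in `D_ξ`, `ΔΨ + ω(Ψ) = 0` in `D_ξ`,
`(1/2)|∇Ψ|² + ξ = R` on the free surface, `Ψ = 1` on the free surface and `Ψ = 0` on the bottom. -/
def IsWaterWave (ω : ℝ → ℝ) (Ψ : ℝ × ℝ → ℝ) (ξ : ℝ → ℝ) (R : ℝ) : Prop :=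
  (∀ X : ℝ, 0 < ξ X) ∧ ContDiff ℝ 1 ξ ∧ ContDiffOn ℝ 1 ω (Set.Icc 0 1) ∧
  ContDiffOn ℝ 1 Ψ (closure (fluidDomain ξ)) ∧ ContDiffOn ℝ 2 Ψ (fluidDomain ξ) ∧
  (∀ z ∈ fluidDomain ξ,
    fderiv ℝ (psiX ξ Ψ) z (1, 0) + fderiv ℝ (psiY ξ Ψ) z (0, 1) + ω (Ψ z) = 0) ∧
  (∀ X : ℝ, (1/2) * ((psiX ξ Ψ (X, ξ X)) ^ 2 + (psiY ξ Ψ (X, ξ X)) ^ 2) + ξ X = R) ∧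
  (∀ X : ℝ, Ψ (X, ξ X) = 1) ∧
  (∀ X : ℝ, Ψ (X, 0) = 0)

/-- `R0 ω = liminf_{θ→θ₀⁺} ℛ(θ)` (as an extended real number). -/
noncomputable def R0 (ω : ℝ → ℝ) : EReal :=
  Filter.liminf (fun θ => (Rcal ω θ : EReal)) (nhdsWithin (theta0 ω) (Set.Ioi (theta0 ω)))

theorem second_deriv_nonneg_of_isLocalMin {f f' : ℝ → ℝ} {a c : ℝ} (hmin : IsLocalMin f a)
    (hf : ∀ᶠ x in nhds a, HasDerivAt f (f' x) x) (hf' : HasDerivAt f' c a) : 0 ≤ c := by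
  by_contra! hc
  have h0 : f' a = 0 := hmin.hasDerivAt_eq_zero hf.self_of_nhds
  have hd : deriv f =ᶠ[nhds a] f' := hf.mono fun x hx => hx.deriv
  have hmax : IsLocalMax f a := by
    apply isLocalMax_of_deriv_deriv_neg
    · rw [hd.deriv_eq, hf'.deriv]; exact hc
    · rw [hd.self_of_nhds, h0]
    · exact hf.self_of_nhds.continuousAt
  have heq : f =ᶠ[nhds a] fun _ => f a := by
    filter_upwards [hmin, hmax] with x h1 h2 using le_antisymm h2 h1
  have hd0 : f' =ᶠ[nhds a] fun _ => 0 := by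
    filter_upwards [heq.eventually_nhds, hd] with x hx hx'
    rw [← hx', Filter.EventuallyEq.deriv_eq hx, deriv_const]
  have : c = 0 := by
    rw [← hf'.deriv, hd0.deriv_eq, deriv_const]
  linarith

theorem mul_sub_nonneg_of_isMinOn {f : ℝ → ℝ} {s : Set ℝ} {x y c : ℝ} (hs : Convex ℝ s)
    (hmin : ∀ z ∈ s, f x ≤ f z) (hf : HasDerivWithinAt f c s x) (hx : x ∈ s) (hy : y ∈ s) :
    0 ≤ (y - x) * c := by
  have hm : IsLocalMinOn f s x := (show IsMinOn f s x from hmin).localize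
  simpa using hm.hasFDerivWithinAt_nonneg hf.hasFDerivWithinAt
    (sub_mem_posTangentConeAt_of_segment_subset (hs.segment_subset hx hy))

theorem exists_continuous_extension_Omg {ω : ℝ → ℝ} (hω : ContinuousOn ω (Set.Icc 0 1)) :
    ∃ w : ℝ → ℝ, Continuous w ∧ (∀ p ∈ Set.Icc (0:ℝ) 1, w p = ω p) ∧
      ∀ p ∈ Set.Icc (0:ℝ) 1, Omg w p = Omg ω p := by
  have hw : ∀ p ∈ Set.Icc (0:ℝ) 1,
      Set.IccExtend (zero_le_one (α := ℝ)) ((Set.Icc (0:ℝ) 1).domRestrict ω) p = ω p :=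
    fun p hp => Set.IccExtend_of_mem _ _ hp
  refine ⟨_, (continuousOn_iff_continuous_domRestrict.1 hω).Icc_extend', hw, fun p hp => ?_⟩
  refine intervalIntegral.integral_congr fun s hs => hw s ?_
  rw [Set.uIcc_of_le hp.1] at hs
  exact ⟨hs.1, hs.2.trans hp.2⟩

theorem hasDerivAt_Omg {w : ℝ → ℝ} (hw : Continuous w) (p : ℝ) : HasDerivAt (Omg w) (w p) p :=
  intervalIntegral.integral_hasDerivAt_right (hw.intervalIntegrable _ _)
    hw.stronglyMeasurable.stronglyMeasurableAtFilter hw.continuousAt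

theorem continuousOn_Omg {ω : ℝ → ℝ} (hω : ContinuousOn ω (Set.Icc 0 1)) :
    ContinuousOn (Omg ω) (Set.Icc 0 1) := by
  obtain ⟨w, hw, -, hΩ⟩ := exists_continuous_extension_Omg hω
  have : Continuous (Omg w) :=
    continuous_iff_continuousAt.2 fun p => (hasDerivAt_Omg hw p).continuousAt
  exact this.continuousOn.congr fun p hp => (hΩ p hp).symm

/-- At an interior maximum the primitive `Ω` of a `C¹` function is pinched by a parabola. -/
theorem exists_Omg_sub_le_sq {ω : ℝ → ℝ} (hω : ContDiffOn ℝ 1 ω (Set.Icc 0 1)) {q : ℝ}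
    (hq0 : 0 < q) (hq1 : q < 1) (hmax : ∀ p ∈ Set.Icc (0:ℝ) 1, Omg ω p ≤ Omg ω q) :
    ∃ L > 0, ∀ τ ∈ Set.Icc q 1, 2 * (Omg ω q - Omg ω τ) ≤ (L * (τ - q)) ^ 2 := by
  obtain ⟨w, hw, hwω, hΩ⟩ := exists_continuous_extension_Omg hω.continuousOn
  have hqm : q ∈ Set.Icc (0:ℝ) 1 := ⟨hq0.le, hq1.le⟩
  have hq : ω q = 0 := by
    rw [← hwω q hqm]
    refine IsLocalMax.hasDerivAt_eq_zero ?_ (hasDerivAt_Omg hw q)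
    filter_upwards [Icc_mem_nhds hq0 hq1] with p hp
    rw [hΩ p hp, hΩ q hqm]
    exact hmax p hp
  have hcd := hω.continuousOn_derivWithin (uniqueDiffOn_Icc one_pos) le_rfl
  obtain ⟨C, hC⟩ := isCompact_Icc.exists_bound_of_continuousOn hcd
  have hC0 : 0 ≤ C := (norm_nonneg _).trans (hC q hqm)
  have hlip : ∀ τ ∈ Set.Icc (0:ℝ) 1, ‖w τ‖ ≤ C * ‖τ - q‖ := fun τ hτ => by
    have := (convex_Icc (0:ℝ) 1).norm_image_sub_le_of_norm_derivWithin_le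
      (hω.differentiableOn one_ne_zero) hC hqm hτ
    rwa [hq, sub_zero, ← hwω τ hτ] at this
  refine ⟨2 * C + 1, by positivity, fun τ hτ => ?_⟩
  have hτm : τ ∈ Set.Icc (0:ℝ) 1 := ⟨hq0.le.trans hτ.1, hτ.2⟩
  have hsub : Omg w τ - Omg w q = ∫ s in q..τ, w s :=
    intervalIntegral.integral_interval_sub_left (hw.intervalIntegrable _ _)
      (hw.intervalIntegrable _ _)
  have hint : ‖∫ s in q..τ, w s‖ ≤ C * (τ - q) * |τ - q| := by
    refine intervalIntegral.norm_integral_le_of_norm_le_const fun s hs => ?_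
    rw [Set.uIoc_of_le hτ.1] at hs
    refine (hlip s ⟨hq0.le.trans hs.1.le, hs.2.trans hτ.2⟩).trans ?_
    rw [Real.norm_of_nonneg (by linarith [hs.1])]
    exact mul_le_mul_of_nonneg_left (by linarith [hs.2]) hC0
  rw [← hsub, Real.norm_eq_abs, abs_of_nonneg (sub_nonneg.2 hτ.1), hΩ τ hτm, hΩ q hqm] at hint
  have h1 := (abs_le.1 hint).1
  have h2 := sq_nonneg (τ - q)
  nlinarith [mul_nonneg hC0 h2, mul_nonneg (mul_nonneg hC0 hC0) h2]

theorem theta0_sq {ω : ℝ → ℝ} {m : ℝ} (hm0 : 0 ≤ m) (hm : IsGreatest (Omg ω '' Set.Icc 0 1) m) :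
    theta0 ω ^ 2 = 2 * m := by
  rw [theta0, hm.csSup_eq, Real.sq_sqrt (by linarith)]

/-- If `Ω` attains its maximum inside `(0,1)`, then `ℛ(θ)` blows up logarithmically as `θ → θ₀⁺`. -/
theorem R0_eq_top_of_interior_max {ω : ℝ → ℝ} (hω : ContDiffOn ℝ 1 ω (Set.Icc 0 1)) {q : ℝ}
    (hq0 : 0 < q) (hq1 : q < 1) (hmax : ∀ p ∈ Set.Icc (0:ℝ) 1, Omg ω p ≤ Omg ω q)
    (hpos : 0 ≤ Omg ω q) : R0 ω = ⊤ := by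
  obtain ⟨L, hL, hsq⟩ := exists_Omg_sub_le_sq hω hq0 hq1 hmax
  have hθ0 : theta0 ω ^ 2 = 2 * Omg ω q := theta0_sq hpos
    ⟨⟨q, ⟨hq0.le, hq1.le⟩, rfl⟩, by rintro _ ⟨p, hp, rfl⟩; exact hmax p hp⟩
  have hθ0n : 0 ≤ theta0 ω := Real.sqrt_nonneg _
  have hΩc := continuousOn_Omg hω.continuousOn
  have hbound : ∀ θ ∈ Set.Ioi (theta0 ω),
      (Real.log (L * (1 - q)) - Real.log (Real.sqrt (θ ^ 2 - 2 * Omg ω q))) / L - Omg ω 1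
        ≤ Rcal ω θ := by
    intro θ hθ
    have hθ' : theta0 ω < θ := hθ
    have hgap : 0 < θ ^ 2 - 2 * Omg ω q := by rw [← hθ0]; nlinarith
    set σ := Real.sqrt (θ ^ 2 - 2 * Omg ω q) with hσ
    have hσ0 : 0 < σ := Real.sqrt_pos.2 hgap
    have hpos' : ∀ τ ∈ Set.Icc (0:ℝ) 1, 0 < θ ^ 2 - 2 * Omg ω τ := fun τ hτ => by
      linarith [hmax τ hτ]
    have hcont : ContinuousOn (fun τ => 1 / Real.sqrt (θ ^ 2 - 2 * Omg ω τ)) (Set.Icc 0 1) := by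
      refine continuousOn_const.div ?_ fun τ hτ => (Real.sqrt_pos.2 (hpos' τ hτ)).ne'
      exact (continuousOn_const.sub (continuousOn_const.mul hΩc)).sqrt
    have hint : ∀ a b, a ∈ Set.Icc (0:ℝ) 1 → b ∈ Set.Icc (0:ℝ) 1 → IntervalIntegrable
        (fun τ => 1 / Real.sqrt (θ ^ 2 - 2 * Omg ω τ)) MeasureTheory.volume a b :=
      fun a b ha hb => (hcont.mono (Set.uIcc_subset_Icc ha hb)).intervalIntegrable
    have hq : q ∈ Set.Icc (0:ℝ) 1 := ⟨hq0.le, hq1.le⟩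
    have h0 : (0:ℝ) ∈ Set.Icc (0:ℝ) 1 := ⟨le_rfl, zero_le_one⟩
    have h1 : (1:ℝ) ∈ Set.Icc (0:ℝ) 1 := ⟨zero_le_one, le_rfl⟩
    have hsplit := intervalIntegral.integral_add_adjacent_intervals (hint 0 q h0 hq)
      (hint q 1 hq h1)
    have hleft : 0 ≤ ∫ τ in (0:ℝ)..q, 1 / Real.sqrt (θ ^ 2 - 2 * Omg ω τ) :=
      intervalIntegral.integral_nonneg hq0.le fun τ _ => by positivity
    have hden : ∀ τ ∈ Set.Icc q 1, 0 < σ + L * (τ - q) := fun τ hτ => by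
      have := mul_nonneg hL.le (sub_nonneg.2 hτ.1)
      linarith
    have hlin : ContinuousOn (fun τ => 1 / (σ + L * (τ - q))) (Set.uIcc q 1) := by
      rw [Set.uIcc_of_le hq1.le]
      exact continuousOn_const.div (by fun_prop) fun τ hτ => (hden τ hτ).ne'
    have hftc : ∫ τ in q..1, 1 / (σ + L * (τ - q))
        = Real.log (σ + L * (1 - q)) / L - Real.log (σ + L * (q - q)) / L := by
      refine intervalIntegral.integral_eq_sub_of_hasDerivAt
        (f := fun τ => Real.log (σ + L * (τ - q)) / L) (fun τ hτ => ?_) hlin.intervalIntegrable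
      rw [Set.uIcc_of_le hq1.le] at hτ
      have hd : HasDerivAt (fun τ => σ + L * (τ - q)) L τ := by
        simpa using (((hasDerivAt_id τ).sub_const q).const_mul L).const_add σ
      convert! (hd.log (hden τ hτ).ne').div_const L using 1
      field_simp
    have hmono : ∫ τ in q..1, 1 / (σ + L * (τ - q))
        ≤ ∫ τ in q..1, 1 / Real.sqrt (θ ^ 2 - 2 * Omg ω τ) := by
      refine intervalIntegral.integral_mono_on hq1.le hlin.intervalIntegrable (hint q 1 hq h1)
        fun τ hτ => ?_
      have hτ' : τ ∈ Set.Icc (0:ℝ) 1 := ⟨hq0.le.trans hτ.1, hτ.2⟩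
      refine one_div_le_one_div_of_le (Real.sqrt_pos.2 (hpos' τ hτ')) ?_
      refine Real.sqrt_le_iff.2 ⟨(hden τ hτ).le, ?_⟩
      have := hsq τ hτ
      have hs2 : σ ^ 2 = θ ^ 2 - 2 * Omg ω q := Real.sq_sqrt hgap.le
      nlinarith [mul_nonneg hσ0.le (mul_nonneg hL.le (sub_nonneg.2 hτ.1))]
    have hlog : Real.log (L * (1 - q)) ≤ Real.log (σ + L * (1 - q)) :=
      Real.log_le_log (mul_pos hL (by linarith)) (by linarith)
    have hfin : (Real.log (L * (1 - q)) - Real.log σ) / L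
        ≤ Real.log (σ + L * (1 - q)) / L - Real.log (σ + L * (q - q)) / L := by
      rw [sub_self, mul_zero, add_zero, ← sub_div]
      gcongr
    rw [Rcal, ← hsplit]
    nlinarith [sq_nonneg θ]
  have hσ : Filter.Tendsto (fun θ => Real.sqrt (θ ^ 2 - 2 * Omg ω q))
      (nhdsWithin (theta0 ω) (Set.Ioi (theta0 ω))) (nhdsWithin 0 (Set.Ioi 0)) := by
    refine tendsto_nhdsWithin_iff.2 ⟨?_, ?_⟩
    · have hc : Continuous fun θ : ℝ => Real.sqrt (θ ^ 2 - 2 * Omg ω q) := by fun_prop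
      have := hc.tendsto (theta0 ω)
      rw [hθ0, sub_self, Real.sqrt_zero] at this
      exact this.mono_left nhdsWithin_le_nhds
    · filter_upwards [self_mem_nhdsWithin] with θ hθ
      have hθ' : theta0 ω < θ := hθ
      exact Real.sqrt_pos.2 (by rw [← hθ0]; nlinarith)
  have hlog := Filter.tendsto_neg_atBot_atTop.comp (Real.tendsto_log_nhdsGT_zero.comp hσ)
  have htop : Filter.Tendsto (Rcal ω) (nhdsWithin (theta0 ω) (Set.Ioi (theta0 ω)))
      Filter.atTop := by
    refine Filter.tendsto_atTop_mono' _
      (Filter.eventually_of_mem self_mem_nhdsWithin hbound) ?_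
    refine Filter.tendsto_atTop_add_const_right _ _ ?_
    refine Filter.Tendsto.atTop_div_const hL ?_
    exact Filter.tendsto_atTop_add_const_left _ _ hlog
  exact (EReal.tendsto_coe_nhds_top_iff.2 htop).liminf_eq

theorem Omg_le_Omg_one {ω : ℝ → ℝ} (hω : ContDiffOn ℝ 1 ω (Set.Icc 0 1)) (hR0 : R0 ω < ⊤)
    (hΩ1 : 0 < Omg ω 1) : ∀ p ∈ Set.Icc (0:ℝ) 1, Omg ω p ≤ Omg ω 1 := by
  obtain ⟨q, hq, hmax⟩ := isCompact_Icc.exists_isMaxOn (Set.nonempty_Icc.2 zero_le_one)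
    (continuousOn_Omg hω.continuousOn)
  have h1 : Omg ω 1 ≤ Omg ω q := hmax (Set.right_mem_Icc.2 zero_le_one)
  rcases hq.2.eq_or_lt with rfl | hq1
  · exact fun p hp => hmax hp
  · refine absurd (R0_eq_top_of_interior_max hω ?_ hq1 (fun p hp => hmax hp) (hΩ1.le.trans h1)) hR0.ne
    refine hq.1.lt_of_ne ?_
    rintro rfl
    simp [Omg] at h1 hΩ1
    linarith

/-- A reparametrised strict subsolution of `U'' + ω(U) = 0`: `G` is the inverse of a function `U`
with `U'² / 2 + Ω(U) = Ω(1) + ε (1 + U)`, and `g = G'`. -/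
theorem exists_barrier {ω : ℝ → ℝ} (hω : ContinuousOn ω (Set.Icc 0 1))
    (hmax : ∀ p ∈ Set.Icc (0:ℝ) 1, Omg ω p ≤ Omg ω 1) {ε : ℝ} (hε : 0 < ε) :
    ∃ G g : ℝ → ℝ, G 0 = 0 ∧ g 0 = (Real.sqrt (2 * Omg ω 1 + 2 * ε))⁻¹ ∧
      g 1 = (Real.sqrt (4 * ε))⁻¹ ∧
      ∀ p ∈ Set.Icc (0:ℝ) 1, 0 < g p ∧ HasDerivAt G (g p) p ∧
        HasDerivAt g (-(ε - ω p) * g p ^ 3) p := by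
  obtain ⟨w, hw, hwω, hΩ⟩ := exists_continuous_extension_Omg hω
  set Q : ℝ → ℝ := fun p => 2 * (Omg ω 1 - Omg w p) + 2 * ε * (1 + p) with hQ
  have hQd : ∀ p, HasDerivAt Q (2 * (ε - w p)) p := fun p => by
    have h1 := ((hasDerivAt_Omg hw p).const_sub (Omg ω 1)).const_mul 2
    have h2 := ((hasDerivAt_id p).const_add 1).const_mul (2 * ε)
    convert! h1.add h2 using 1
    ring
  have hQc : Continuous Q := continuous_iff_continuousAt.2 fun p => (hQd p).continuousAt
  have hQpos : ∀ p ∈ Set.Icc (0:ℝ) 1, 0 < Q p := fun p hp => by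
    have := hmax p hp
    have := mul_nonneg hε.le hp.1
    simp only [hQ, hΩ p hp]
    linarith
  have hgc : ∀ p ∈ Set.Icc (0:ℝ) 1, ContinuousAt (fun p => (Real.sqrt (Q p))⁻¹) p := fun p hp =>
    (hQc.sqrt.continuousAt).inv₀ (Real.sqrt_pos.2 (hQpos p hp)).ne'
  refine ⟨fun p => ∫ s in (0:ℝ)..p, (Real.sqrt (Q s))⁻¹, fun p => (Real.sqrt (Q p))⁻¹, by simp,
    ?_, ?_, fun p hp => ⟨inv_pos.2 (Real.sqrt_pos.2 (hQpos p hp)), ?_, ?_⟩⟩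
  · simp [hQ, Omg]
  · simp only [hQ, hΩ 1 (Set.right_mem_Icc.2 zero_le_one)]
    ring_nf
  · refine intervalIntegral.integral_hasDerivAt_right ?_ ?_ (hgc p hp)
    · refine ContinuousOn.intervalIntegrable fun s hs => (hgc s ?_).continuousWithinAt
      rw [Set.uIcc_of_le hp.1] at hs
      exact ⟨hs.1, hs.2.trans hp.2⟩
    · exact hQc.sqrt.measurable.inv.stronglyMeasurable.stronglyMeasurableAtFilter
  · have hs := Real.sqrt_pos.2 (hQpos p hp)
    convert! ((hQd p).sqrt (hQpos p hp).ne').inv hs.ne' using 1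
    rw [hwω p hp]
    field_simp

theorem isOpen_fluidDomain {ξ : ℝ → ℝ} (hξ : Continuous ξ) : IsOpen (fluidDomain ξ) :=
  (isOpen_lt continuous_const continuous_snd).inter
    (isOpen_lt continuous_snd (hξ.comp continuous_fst))

theorem mem_closure_fluidDomain {ξ : ℝ → ℝ} {X Y : ℝ} (hξ : 0 < ξ X) (hY : Y ∈ Set.Icc 0 (ξ X)) :
    (X, Y) ∈ closure (fluidDomain ξ) := by
  rw [← closure_Ioo hξ.ne] at hY
  exact map_mem_closure (f := fun Y : ℝ => (X, Y)) (by fun_prop) hY fun y hy => hy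

theorem hasDerivWithinAt_vertical {ξ : ℝ → ℝ} {Ψ : ℝ × ℝ → ℝ}
    (hΨ : DifferentiableOn ℝ Ψ (closure (fluidDomain ξ))) {X Y : ℝ} (hξ : 0 < ξ X)
    (hY : Y ∈ Set.Icc 0 (ξ X)) :
    HasDerivWithinAt (fun y => Ψ (X, y)) (psiY ξ Ψ (X, Y)) (Set.Icc 0 (ξ X)) Y := by
  have h := (hΨ _ (mem_closure_fluidDomain hξ hY)).hasFDerivWithinAt
  exact h.comp_hasDerivWithinAt Y
    ((hasDerivAt_const Y X).prodMk (hasDerivAt_id Y)).hasDerivWithinAt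
    fun y hy => mem_closure_fluidDomain hξ hy

theorem monotoneOn_vertical {ξ : ℝ → ℝ} {Ψ : ℝ × ℝ → ℝ}
    (hΨ : DifferentiableOn ℝ Ψ (closure (fluidDomain ξ)))
    (hmono : ∀ z ∈ closure (fluidDomain ξ), 0 ≤ psiY ξ Ψ z) {X : ℝ} (hξ : 0 < ξ X) :
    MonotoneOn (fun y => Ψ (X, y)) (Set.Icc 0 (ξ X)) := by
  have hd : ∀ y ∈ interior (Set.Icc 0 (ξ X)), HasDerivAt (fun y => Ψ (X, y)) (psiY ξ Ψ (X, y)) y :=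
    fun y hy => (hasDerivWithinAt_vertical hΨ hξ (interior_subset hy)).hasDerivAt
      (mem_interior_iff_mem_nhds.1 hy)
  refine monotoneOn_of_deriv_nonneg (convex_Icc _ _)
    (fun y hy => (hasDerivWithinAt_vertical hΨ hξ hy).continuousWithinAt)
    (fun y hy => (hd y hy).differentiableAt.differentiableWithinAt) fun y hy => ?_
  rw [(hd y hy).deriv]
  exact hmono _ (mem_closure_fluidDomain hξ (interior_subset hy))

theorem hasFDerivAt_of_mem_fluidDomain {ξ : ℝ → ℝ} {Ψ : ℝ × ℝ → ℝ} (hξ : Continuous ξ)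
    (hΨ : DifferentiableOn ℝ Ψ (closure (fluidDomain ξ))) {z : ℝ × ℝ} (hz : z ∈ fluidDomain ξ) :
    HasFDerivAt Ψ (fderivWithin ℝ Ψ (closure (fluidDomain ξ)) z) z :=
  (hΨ z (subset_closure hz)).hasFDerivWithinAt.hasFDerivAt
    (Filter.mem_of_superset ((isOpen_fluidDomain hξ).mem_nhds hz) subset_closure)

theorem differentiableAt_fderivWithin_apply {ξ : ℝ → ℝ} {Ψ : ℝ × ℝ → ℝ} (hξ : Continuous ξ)
    (hΨ : DifferentiableOn ℝ Ψ (closure (fluidDomain ξ))) (hΨ2 : ContDiffOn ℝ 2 Ψ (fluidDomain ξ))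
    {z : ℝ × ℝ} (hz : z ∈ fluidDomain ξ) (e : ℝ × ℝ) :
    DifferentiableAt ℝ (fun y => fderivWithin ℝ Ψ (closure (fluidDomain ξ)) y e) z := by
  have hnhds := (isOpen_fluidDomain hξ).mem_nhds hz
  have h1 : DifferentiableAt ℝ (fderiv ℝ Ψ) z :=
    ((hΨ2.contDiffAt hnhds).fderiv_right (m := 1) le_rfl).differentiableAt one_ne_zero
  refine (h1.clm_apply (differentiableAt_const e)).congr_of_eventuallyEq ?_
  filter_upwards [hnhds] with y hy
  rw [(hasFDerivAt_of_mem_fluidDomain hξ hΨ hy).fderiv]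

theorem HasFDerivAt.hasDerivAt_fst {f : ℝ × ℝ → ℝ} {f' : ℝ × ℝ →L[ℝ] ℝ} {z : ℝ × ℝ}
    (h : HasFDerivAt f f' z) : HasDerivAt (fun x => f (x, z.2)) (f' (1, 0)) z.1 :=
  h.comp_hasDerivAt z.1 ((hasDerivAt_id z.1).prodMk (hasDerivAt_const z.1 z.2))

theorem HasFDerivAt.hasDerivAt_snd {f : ℝ × ℝ → ℝ} {f' : ℝ × ℝ →L[ℝ] ℝ} {z : ℝ × ℝ}
    (h : HasFDerivAt f f' z) : HasDerivAt (fun y => f (z.1, y)) (f' (0, 1)) z.2 :=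
  h.comp_hasDerivAt z.2 ((hasDerivAt_const z.2 z.1).prodMk (hasDerivAt_id z.2))

/-- First and second order conditions at an interior minimum of `G(Ψ) - Y + η X²`, where `G` comes
from `exists_barrier`. -/
theorem barrier_le_of_isLocalMin {Ψ u v : ℝ × ℝ → ℝ} {D : Set (ℝ × ℝ)} (hD : IsOpen D)
    {G g : ℝ → ℝ} {z : ℝ × ℝ} {a b c ε η : ℝ} (hz : z ∈ D)
    (hu : ∀ y ∈ D, HasDerivAt (fun x => Ψ (x, y.2)) (u y) y.1)
    (hv : ∀ y ∈ D, HasDerivAt (fun x => Ψ (y.1, x)) (v y) y.2)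
    (hua : HasDerivAt (fun x => u (x, z.2)) a z.1) (hvb : HasDerivAt (fun x => v (z.1, x)) b z.2)
    (hab : a + b + c = 0) (hG : ∀ y ∈ D, HasDerivAt G (g (Ψ y)) (Ψ y))
    (hg : HasDerivAt g (-(ε - c) * g (Ψ z) ^ 3) (Ψ z))
    (hmin : IsLocalMin (fun y : ℝ × ℝ => G (Ψ y) - y.2 + η * y.1 ^ 2) z) :
    g (Ψ z) * (ε + (ε - c) * (2 * η * z.1) ^ 2) ≤ 2 * η := by
  have hcx : Filter.Tendsto (fun x : ℝ => (x, z.2)) (nhds z.1) (nhds z) :=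
    (show Continuous fun x : ℝ => (x, z.2) by fun_prop).tendsto z.1
  have hcy : Filter.Tendsto (fun x : ℝ => (z.1, x)) (nhds z.2) (nhds z) :=
    (show Continuous fun x : ℝ => (z.1, x) by fun_prop).tendsto z.2
  have hminx : IsLocalMin (fun x => G (Ψ (x, z.2)) - z.2 + η * x ^ 2) z.1 := hcx.eventually hmin
  have hminy : IsLocalMin (fun x => G (Ψ (z.1, x)) - x + η * z.1 ^ 2) z.2 := hcy.eventually hmin
  have hdx : ∀ y ∈ D, HasDerivAt (fun x => G (Ψ (x, y.2)) - y.2 + η * x ^ 2)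
      (g (Ψ y) * u y + η * (2 * y.1)) y.1 := fun y hy => by
    have h1 := (HasDerivAt.comp (h₂ := G) y.1 (hG y hy) (hu y hy)).sub_const y.2
    have h2 := ((hasDerivAt_id y.1).pow 2).const_mul η
    convert! h1.add h2 using 1
    simp
  have hdy : ∀ y ∈ D, HasDerivAt (fun x => G (Ψ (y.1, x)) - x + η * y.1 ^ 2)
      (g (Ψ y) * v y - 1) y.2 := fun y hy =>
    ((HasDerivAt.comp (h₂ := G) y.2 (hG y hy) (hv y hy)).sub (hasDerivAt_id y.2)).add_const _
  have hx0 : g (Ψ z) * u z + η * (2 * z.1) = 0 := hminx.hasDerivAt_eq_zero (hdx z hz)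
  have hy0 : g (Ψ z) * v z - 1 = 0 := hminy.hasDerivAt_eq_zero (hdy z hz)
  have hxx : 0 ≤ -(ε - c) * g (Ψ z) ^ 3 * u z * u z + g (Ψ z) * a + η * 2 := by
    refine second_deriv_nonneg_of_isLocalMin hminx
      (f' := fun x => g (Ψ (x, z.2)) * u (x, z.2) + η * (2 * x))
      ((hcx.eventually (hD.mem_nhds hz)).mono fun x hx => hdx (x, z.2) hx) ?_
    have h1 := (HasDerivAt.comp (h₂ := g) z.1 hg (hu z hz)).mul hua
    have h2 := ((hasDerivAt_id z.1).const_mul 2).const_mul η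
    convert! h1.add h2 using 1
    simp
  have hyy : 0 ≤ -(ε - c) * g (Ψ z) ^ 3 * v z * v z + g (Ψ z) * b := by
    refine second_deriv_nonneg_of_isLocalMin hminy
      (f' := fun x => g (Ψ (z.1, x)) * v (z.1, x) - 1)
      ((hcy.eventually (hD.mem_nhds hz)).mono fun x hx => hdy (z.1, x) hx) ?_
    exact ((HasDerivAt.comp (h₂ := g) z.2 hg (hv z hz)).mul hvb).sub_const 1
  have hu2 : g (Ψ z) * u z = -(2 * η * z.1) := by linarith
  have hv2 : g (Ψ z) * v z = 1 := by linarith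
  have e1 : g (Ψ z) ^ 3 * u z * u z = g (Ψ z) * (2 * η * z.1) ^ 2 := by
    rw [← neg_sq (2 * η * z.1), ← hu2]; ring
  have e2 : g (Ψ z) ^ 3 * v z * v z = g (Ψ z) := by
    calc _ = g (Ψ z) * (g (Ψ z) * v z) ^ 2 := by ring
      _ = _ := by rw [hv2]; ring
  have hb : b = -c - a := by linarith
  rw [hb] at hyy
  linear_combination hxx + hyy - (ε - c) * e1 - (ε - c) * e2

/-- Comparison principle: `Y ≤ G(Ψ)`, i.e. `Ψ` lies above the strict subsolution whose inverse is `G`,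
provided the subsolution has slope `1 / g 1 < δ` where it reaches the value `1`. -/
theorem le_barrier {ω : ℝ → ℝ} {Ψ : ℝ × ℝ → ℝ} {ξ : ℝ → ℝ} {R δ ε : ℝ} {G g : ℝ → ℝ}
    (hww : IsWaterWave ω Ψ ξ R) (hmono : ∀ z ∈ closure (fluidDomain ξ), 0 ≤ psiY ξ Ψ z)
    (hsurf : ∀ X : ℝ, δ ≤ psiY ξ Ψ (X, ξ X)) (hε : 0 < ε) (hG0 : G 0 = 0) (hg1 : 1 < g 1 * δ)
    (hGg : ∀ p ∈ Set.Icc (0:ℝ) 1, 0 < g p ∧ HasDerivAt G (g p) p ∧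
        HasDerivAt g (-(ε - ω p) * g p ^ 3) p) {X Y : ℝ} (hY : Y ∈ Set.Icc 0 (ξ X)) :
    Y ≤ G (Ψ (X, Y)) := by
  obtain ⟨hξ, hξC, hω, hΨ1, hΨ2, hpde, hbern, htop, hbot⟩ := hww
  have hΨd := hΨ1.differentiableOn one_ne_zero
  have hξR : ∀ x, ξ x ≤ R := fun x => by
    have := hbern x
    nlinarith [sq_nonneg (psiX ξ Ψ (x, ξ x)), sq_nonneg (psiY ξ Ψ (x, ξ x))]
  have hR : 0 < R := (hξ 0).trans_le (hξR 0)
  have hΨmem : ∀ x y, y ∈ Set.Icc 0 (ξ x) → Ψ (x, y) ∈ Set.Icc (0:ℝ) 1 := fun x y hy => by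
    have hm := monotoneOn_vertical hΨd hmono (hξ x)
    refine ⟨?_, ?_⟩
    · rw [← hbot x]; exact hm (Set.left_mem_Icc.2 (hξ x).le) hy hy.1
    · rw [← htop x]; exact hm hy (Set.right_mem_Icc.2 (hξ x).le) hy.2
  have hgc : ContinuousOn g (Set.Icc 0 1) := fun p hp => (hGg p hp).2.2.continuousAt.continuousWithinAt
  have hGc : ContinuousOn G (Set.Icc 0 1) := fun p hp => (hGg p hp).2.1.continuousAt.continuousWithinAt
  have hGnn : ∀ p ∈ Set.Icc (0:ℝ) 1, 0 ≤ G p := fun p hp => by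
    rw [← hG0]
    refine monotoneOn_of_deriv_nonneg (convex_Icc 0 1) hGc (fun q hq => ?_) (fun q hq => ?_)
      (Set.left_mem_Icc.2 zero_le_one) hp hp.1
    · exact (hGg q (interior_subset hq)).2.1.differentiableAt.differentiableWithinAt
    · rw [(hGg q (interior_subset hq)).2.1.deriv]
      exact (hGg q (interior_subset hq)).1.le
  obtain ⟨W, hW⟩ := isCompact_Icc.exists_bound_of_continuousOn hω.continuousOn
  have hW0 : 0 ≤ W := (norm_nonneg _).trans (hW 0 (Set.left_mem_Icc.2 zero_le_one))
  obtain ⟨p₀, hp₀, hγ⟩ := isCompact_Icc.exists_isMinOn (Set.nonempty_Icc.2 zero_le_one) hgc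
  have hγ0 := (hGg p₀ hp₀).1
  have key : ∀ η : ℝ, 0 < η → W * (4 * η * R) < ε / 2 → 2 * η < g p₀ * (ε / 2) →
      0 ≤ G (Ψ (X, Y)) - Y + η * X ^ 2 := by
    intro η hη hη1 hη2
    by_contra! hneg
    set F : ℝ × ℝ → ℝ := fun y => G (Ψ y) - y.2 + η * y.1 ^ 2 with hF
    set A : ℝ := Real.sqrt (R / η) with hA
    have hA2 : η * A ^ 2 = R := by
      rw [hA, Real.sq_sqrt (by positivity)]; field_simp
    set K : Set (ℝ × ℝ) := {y | y.1 ∈ Set.Icc (-A) A ∧ y.2 ∈ Set.Icc 0 (ξ y.1)} with hK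
    have hnegmem : ∀ y : ℝ × ℝ, y.2 ∈ Set.Icc 0 (ξ y.1) → F y < 0 →
        η * y.1 ^ 2 < R ∧ y.1 ∈ Set.Ioo (-A) A := fun y hy hFy => by
      have h1 := hGnn _ (hΨmem y.1 y.2 hy)
      have h2 := hy.2.trans (hξR y.1)
      simp only [hF] at hFy
      have h3 : η * y.1 ^ 2 < R := by linarith
      refine ⟨h3, abs_lt.1 (abs_lt_of_sq_lt_sq ?_ (Real.sqrt_nonneg _))⟩
      exact lt_of_mul_lt_mul_left (h3.trans_eq hA2.symm) hη.le
    have hKc : IsCompact K := by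
      have hcl : IsClosed K := by
        refine (isClosed_Icc.preimage continuous_fst).inter
          ((isClosed_le continuous_const continuous_snd).inter
            (isClosed_le continuous_snd (hξC.continuous.comp continuous_fst)))
      refine ((isCompact_Icc (a := -A) (b := A)).prod (isCompact_Icc (a := (0:ℝ)) (b := R))).of_isClosed_subset hcl ?_
      rintro y ⟨h1, h2⟩
      exact ⟨h1, h2.1, h2.2.trans (hξR _)⟩
    have hFc : ContinuousOn F K := by
      have h1 : ContinuousOn (fun y => G (Ψ y)) K := by
        refine hGc.comp (hΨ1.continuousOn.mono ?_) fun y hy => hΨmem y.1 y.2 hy.2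
        exact fun y hy => mem_closure_fluidDomain (hξ y.1) hy.2
      exact (h1.sub continuousOn_snd).add (by fun_prop)
    have hXK : (X, Y) ∈ K := by
      have := (hnegmem (X, Y) hY hneg).2
      exact ⟨⟨this.1.le, this.2.le⟩, hY⟩
    obtain ⟨z, hzK, hzmin⟩ := hKc.exists_isMinOn ⟨_, hXK⟩ hFc
    have hFz : F z < 0 := (hzmin hXK).trans_lt hneg
    obtain ⟨hzR, hzA⟩ := hnegmem z hzK.2 hFz
    have hz0 : 0 < z.2 := by
      refine hzK.2.1.lt_of_ne fun h0 => ?_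
      have : z = (z.1, 0) := Prod.ext rfl h0.symm
      rw [this] at hFz
      simp only [hF, hbot, hG0] at hFz
      nlinarith [sq_nonneg z.1]
    have hzξ : z.2 < ξ z.1 := by
      refine hzK.2.2.lt_of_ne fun h0 => ?_
      have hz : z = (z.1, ξ z.1) := Prod.ext rfl h0
      have hd := hasDerivWithinAt_vertical hΨd (hξ z.1) (Set.right_mem_Icc.2 (hξ z.1).le)
      have h1 : (1:ℝ) ∈ Set.Icc (0:ℝ) 1 := Set.right_mem_Icc.2 zero_le_one
      have hG1 : HasDerivAt G (g 1) (Ψ (z.1, ξ z.1)) := by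
        rw [htop]; exact (hGg 1 h1).2.1
      have hdF : HasDerivWithinAt (fun y => F (z.1, y)) (g 1 * psiY ξ Ψ (z.1, ξ z.1) - 1)
          (Set.Icc 0 (ξ z.1)) (ξ z.1) :=
        ((hG1.comp_hasDerivWithinAt (ξ z.1) hd).sub (hasDerivWithinAt_id _ _)).add_const
          (η * z.1 ^ 2)
      have := mul_sub_nonneg_of_isMinOn (convex_Icc _ _) (fun y hy => ?_) hdF
        (Set.right_mem_Icc.2 (hξ z.1).le) (Set.left_mem_Icc.2 (hξ z.1).le)
      · have h2 := mul_le_mul_of_nonneg_left (hsurf z.1) (hGg 1 h1).1.le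
        nlinarith [hξ z.1]
      · rw [← hz]
        exact hzmin (show (z.1, y) ∈ K from ⟨hzK.1, hy⟩)
    have hzD : z ∈ fluidDomain ξ := ⟨hz0, hzξ⟩
    have hDo := isOpen_fluidDomain hξC.continuous
    have hloc : IsLocalMin F z := by
      filter_upwards [hDo.mem_nhds hzD, continuous_fst.continuousAt.preimage_mem_nhds
        (Ioo_mem_nhds hzA.1 hzA.2)] with y hy hyA
      exact hzmin (show y ∈ K from ⟨⟨hyA.1.le, hyA.2.le⟩, hy.1.le, hy.2.le⟩)
    have hΨD : ∀ y ∈ fluidDomain ξ, Ψ y ∈ Set.Icc (0:ℝ) 1 := fun y hy =>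
      hΨmem y.1 y.2 ⟨hy.1.le, hy.2.le⟩
    have hpz := hΨD z hzD
    have hfin := barrier_le_of_isLocalMin hDo hzD (u := psiX ξ Ψ) (v := psiY ξ Ψ)
      (fun y hy => (hasFDerivAt_of_mem_fluidDomain hξC.continuous hΨd hy).hasDerivAt_fst)
      (fun y hy => (hasFDerivAt_of_mem_fluidDomain hξC.continuous hΨd hy).hasDerivAt_snd)
      (differentiableAt_fderivWithin_apply hξC.continuous hΨd hΨ2 hzD
        (1, 0)).hasFDerivAt.hasDerivAt_fst
      (differentiableAt_fderivWithin_apply hξC.continuous hΨd hΨ2 hzD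
        (0, 1)).hasFDerivAt.hasDerivAt_snd
      (hpde z hzD) (fun y hy => (hGg _ (hΨD y hy)).2.1) (hGg _ hpz).2.2 hloc
    have hωW := (abs_le.1 (hW _ hpz)).2
    have hs : (2 * η * z.1) ^ 2 ≤ 4 * η * R := by nlinarith
    have h1 : ε / 2 ≤ ε + (ε - ω (Ψ z)) * (2 * η * z.1) ^ 2 := by
      have h2 := mul_le_mul_of_nonneg_left hs hW0
      nlinarith [sq_nonneg (2 * η * z.1)]
    have h3 : g p₀ * (ε / 2) ≤ g (Ψ z) * (ε + (ε - ω (Ψ z)) * (2 * η * z.1) ^ 2) :=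
      mul_le_mul (hγ hpz) h1 (by positivity) (hGg _ hpz).1.le
    linarith
  have hlim : Filter.Tendsto (fun η : ℝ => G (Ψ (X, Y)) - Y + η * X ^ 2) (nhdsWithin 0 (Set.Ioi 0))
      (nhds (G (Ψ (X, Y)) - Y)) := by
    have hc : Continuous fun η : ℝ => G (Ψ (X, Y)) - Y + η * X ^ 2 := by fun_prop
    simpa using (hc.tendsto 0).mono_left nhdsWithin_le_nhds
  refine sub_nonneg.1 (ge_of_tendsto hlim ?_)
  have e1 : ∀ᶠ η : ℝ in nhds 0, W * (4 * η * R) < ε / 2 :=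
    (show Continuous fun η : ℝ => W * (4 * η * R) by fun_prop).continuousAt.eventually_lt
      continuousAt_const (by simpa using hε)
  have e2 : ∀ᶠ η : ℝ in nhds 0, 2 * η < g p₀ * (ε / 2) :=
    (show Continuous fun η : ℝ => 2 * η by fun_prop).continuousAt.eventually_lt
      continuousAt_const (by rw [mul_zero]; positivity)
  filter_upwards [self_mem_nhdsWithin, nhdsWithin_le_nhds e1, nhdsWithin_le_nhds e2]
    with η h0 h1 h2 using key η h0 h1 h2

/-- bottom velocity bound in the case `R₀ < ∞`, `Ω(1) > 0`. If `(Ψ, ξ, R)` solves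
the water-wave problem with `R > R_c`, `Ψ_Y ≥ 0` on the closure of `D_ξ`, and `Ψ_Y ≥ δ > 0` on
the free surface, then `Ψ_Y(X, 0) ≥ θ₀` for every `X`. -/
theorem stmt17 (ω : ℝ → ℝ) (Ψ : ℝ × ℝ → ℝ) (ξ : ℝ → ℝ) (R δ : ℝ)
    (hR0 : R0 ω < ⊤) (hΩ1 : 0 < Omg ω 1)
    (hww : IsWaterWave ω Ψ ξ R) (hRc : Rc ω < R)
    (hmono : ∀ z ∈ closure (fluidDomain ξ), 0 ≤ psiY ξ Ψ z)
    (hδ : 0 < δ) (hsurf : ∀ X : ℝ, δ ≤ psiY ξ Ψ (X, ξ X)) :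
    ∀ X : ℝ, theta0 ω ≤ psiY ξ Ψ (X, 0) := by
  intro X
  have hω := hww.2.2.1
  have hmax := Omg_le_Omg_one hω hR0 hΩ1
  set ε : ℝ := δ ^ 2 / 16 with hε_def
  have hε : 0 < ε := by positivity
  obtain ⟨G, g, hG0, hg0, hg1, hGg⟩ := exists_barrier hω.continuousOn hmax hε
  have h4 : Real.sqrt (4 * ε) = δ / 2 := by
    rw [show 4 * ε = (δ / 2) ^ 2 by rw [hε_def]; ring, Real.sqrt_sq (by positivity)]
  have hg1δ : 1 < g 1 * δ := by
    rw [hg1, h4, inv_div, div_mul_cancel₀ _ hδ.ne']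
    norm_num
  have hle : ∀ Y ∈ Set.Icc 0 (ξ X), Y ≤ G (Ψ (X, Y)) := fun Y hY =>
    le_barrier hww hmono hsurf hε hG0 hg1δ hGg hY
  obtain ⟨hξ, -, -, hΨ1, -, -, -, -, hbot⟩ := hww
  have h0 : (0:ℝ) ∈ Set.Icc 0 (ξ X) := Set.left_mem_Icc.2 (hξ X).le
  have hG : HasDerivAt G (g 0) (Ψ (X, 0)) := by
    rw [hbot]
    exact (hGg 0 (Set.left_mem_Icc.2 zero_le_one)).2.1
  have hd : HasDerivWithinAt (fun Y => G (Ψ (X, Y)) - Y) (g 0 * psiY ξ Ψ (X, 0) - 1)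
      (Set.Icc 0 (ξ X)) 0 :=
    (hG.comp_hasDerivWithinAt 0 (hasDerivWithinAt_vertical
      (hΨ1.differentiableOn one_ne_zero) (hξ X) h0)).sub (hasDerivWithinAt_id _ _)
  have hslope := mul_sub_nonneg_of_isMinOn (convex_Icc _ _) (fun Y hY => by
    rw [hbot, hG0, sub_zero]
    exact sub_nonneg.2 (hle Y hY)) hd h0 (Set.right_mem_Icc.2 (hξ X).le)
  have hone : 1 ≤ g 0 * psiY ξ Ψ (X, 0) := by
    rw [sub_zero] at hslope
    linarith [nonneg_of_mul_nonneg_right hslope (hξ X)]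
  rw [hg0, inv_mul_eq_div, one_le_div (Real.sqrt_pos.2 (by linarith))] at hone
  refine le_trans ?_ hone
  have hgreat : IsGreatest (Omg ω '' Set.Icc 0 1) (Omg ω 1) :=
    ⟨⟨1, Set.right_mem_Icc.2 zero_le_one, rfl⟩, by rintro _ ⟨p, hp, rfl⟩; exact hmax p hp⟩
  rw [theta0, hgreat.csSup_eq]
  exact Real.sqrt_le_sqrt (by linarith)
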